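/- Let K ≥ 2 be an integer, let V ≥ 2 be an integer, and let p be a real number with 1/V < p < 1. Then ψ(p) < ψ(1/V), where ψ(q) = (K − Σ_{k=1}^{K} q^k)/(1 − q^K). -/

import Mathlib

/-- For `0 < q < p`, the ratio of a shorter to a longer geometric sum is smaller at `p`. -/
theorem geom_sum_mul_geom_sum_lt {p q : ℝ} (hq : 0 < q) (hqp : q < p) {k m : ℕ} (hk : 0 < k)
    (hm : 0 < m) :
    (∑ i ∈ Finset.range k, p ^ i) * ∑ j ∈ Finset.range (k + m), q ^ j <
      (∑ i ∈ Finset.range k, q ^ i) * ∑ j ∈ Finset.range (k + m), p ^ j := by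
  have hp : 0 < p := hq.trans hqp
  have key : (∑ i ∈ Finset.range k, p ^ i) * ∑ j ∈ Finset.range m, q ^ (k + j) <
      (∑ i ∈ Finset.range k, q ^ i) * ∑ j ∈ Finset.range m, p ^ (k + j) := by
    rw [Finset.sum_mul_sum, Finset.sum_mul_sum]
    refine Finset.sum_lt_sum_of_nonempty (by simpa using hk.ne') fun i hi => ?_
    refine Finset.sum_lt_sum_of_nonempty (by simpa using hm.ne') fun j _ => ?_
    have hi := Finset.mem_range.1 hi
    obtain ⟨d, hd⟩ : ∃ d, k + j = i + d := ⟨k + j - i, by omega⟩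
    have hlt : q ^ d < p ^ d := pow_lt_pow_left₀ hqp hq.le (by omega)
    calc p ^ i * q ^ (k + j) = p ^ i * q ^ i * q ^ d := by rw [hd, pow_add]; ring
      _ < p ^ i * q ^ i * p ^ d := by gcongr
      _ = q ^ i * p ^ (k + j) := by rw [hd, pow_add]; ring
  rw [Finset.sum_range_add, Finset.sum_range_add]
  linarith

/-- For `0 < k < n`, the function `q ↦ (1 - q ^ k) / (1 - q ^ n)` is strictly decreasing on
`(0, 1)`. -/
theorem one_sub_pow_div_one_sub_pow_lt {p q : ℝ} (hq : 0 < q) (hqp : q < p) (hp : p < 1)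
    {k n : ℕ} (hk : 0 < k) (hkn : k < n) :
    (1 - p ^ k) / (1 - p ^ n) < (1 - q ^ k) / (1 - q ^ n) := by
  have hp0 : 0 < p := hq.trans hqp
  have hn : n ≠ 0 := by omega
  rw [div_lt_div_iff₀ (sub_pos.2 (pow_lt_one₀ hp0.le hp hn))
    (sub_pos.2 (pow_lt_one₀ hq.le (hqp.trans hp) hn))]
  obtain ⟨m, rfl⟩ := Nat.exists_eq_add_of_le hkn.le
  simp only [← mul_neg_geom_sum]
  have h := mul_lt_mul_of_pos_left
    (geom_sum_mul_geom_sum_lt hq hqp hk (show 0 < m by omega))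
    (mul_pos (sub_pos.2 hp) (sub_pos.2 (hqp.trans hp)))
  linarith

theorem psi_p_lt_psi_invV (K V : ℕ) (hK : 2 ≤ K) (hV : 2 ≤ V)
    (p : ℝ) (hp1 : 1 / (V : ℝ) < p) (hp2 : p < 1) :
    ((K : ℝ) - ∑ k ∈ Finset.Icc 1 K, p ^ k) / (1 - p ^ K) <
      ((K : ℝ) - ∑ k ∈ Finset.Icc 1 K, (1 / (V : ℝ)) ^ k) /
        (1 - (1 / (V : ℝ)) ^ K) := by
  have hq : 0 < 1 / (V : ℝ) := by positivity
  generalize 1 / (V : ℝ) = q at hp1 hq ⊢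
  have hsum (x : ℝ) : ((K : ℝ) - ∑ k ∈ Finset.Icc 1 K, x ^ k) / (1 - x ^ K) =
      ∑ k ∈ Finset.Icc 1 K, (1 - x ^ k) / (1 - x ^ K) := by
    rw [← Finset.sum_div, Finset.sum_sub_distrib]
    simp
  rw [hsum, hsum]
  refine Finset.sum_lt_sum (fun k hk => ?_) ⟨1, Finset.mem_Icc.2 ⟨le_rfl, by omega⟩,
    one_sub_pow_div_one_sub_pow_lt hq hp1 hp2 one_pos (by omega)⟩
  obtain ⟨hk1, hkK⟩ := Finset.mem_Icc.1 hk
  obtain rfl | hlt := hkK.eq_or_lt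
  · rw [div_self (sub_pos.2 (pow_lt_one₀ (hq.trans hp1).le hp2 (by omega))).ne',
      div_self (sub_pos.2 (pow_lt_one₀ hq.le (hp1.trans hp2) (by omega))).ne']
  · exact (one_sub_pow_div_one_sub_pow_lt hq hp1 hp2 hk1 hlt).le
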